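/- arXiv:1907.13094 — 2 statements merged into one kernel-verified Lean document; each statement's English description precedes it below -/
import Mathlib

section
/- On the free vector space KP with basis the set of all compositions, the box-adding up operator Ũ = Σ_{i≥1} 𝔱_i and the down operator D = Σ_{i≥1} 𝔡_i satisfy DŨ − ŨD = Id. (Equivalently, the left composition poset L_c and the quasisymmetric composition poset Q_c are dual graded graphs.) -/
namespace CompOps

/-- Subtract 1 from the rightmost part equal to `i`; `none` if no part equals `i`. -/
def removeAux (i : ℕ) : List ℕ → Option (List ℕ)
  | [] => none
  | x :: xs =>
    match removeAux i xs with
    | some ys => some (x :: ys)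
    | none => if x = i then some ((i - 1) :: xs) else none

/-- The box removing operator `𝔡ᵢ`, acting on weak compositions together with a
formal zero (`none`); `𝔡₀` is the identity. -/
def d : ℕ → Option (List ℕ) → Option (List ℕ)
  | 0, o => o
  | i + 1, o => o.bind (removeAux (i + 1))

/-- The appending operator `aᵢ`, appending a part `i` at the end. -/
def a (i : ℕ) : Option (List ℕ) → Option (List ℕ) :=
  Option.map (fun l => l ++ [i])

/-- `𝔡_I` for a finite set `I = {i₁ < ⋯ < i_k}`: the composite
`𝔡_{i₁}𝔡_{i₂}⋯𝔡_{i_k}`, where `𝔡_{i_k}` (the largest index) acts first. -/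
def dSet (I : Finset ℕ) : Option (List ℕ) → Option (List ℕ) :=
  (I.sort (· ≤ ·)).foldr (fun i f => d i ∘ f) id

/-- The jdt operator `𝔲ᵢ = aᵢ 𝔡_{[i-1]}` (with `𝔲₀` the identity). -/
def u : ℕ → Option (List ℕ) → Option (List ℕ)
  | 0 => id
  | i + 1 => a (i + 1) ∘ dSet (Finset.Icc 1 i)

/-- Add 1 to the leftmost part equal to `j`; `none` if no part equals `j`. -/
def addAux (j : ℕ) : List ℕ → Option (List ℕ)
  | [] => none
  | x :: xs => if x = j then some ((x + 1) :: xs) else (addAux j xs).map (x :: ·)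

/-- The box adding operator `𝔱ᵢ`: `𝔱₁` prepends a part 1, and for `i ≥ 2`, `𝔱ᵢ`
adds 1 to the leftmost part equal to `i - 1` (formal zero if there is none). -/
def t : ℕ → Option (List ℕ) → Option (List ℕ)
  | 0 => id
  | 1 => Option.map (fun l => 1 :: l)
  | i + 2 => fun o => o.bind (addAux (i + 1))

/-- Compositions: finite lists of positive integers. -/
abbrev Comp := {l : List ℕ // ∀ x ∈ l, 0 < x}

/-- Send a weak composition (or the formal zero `none`) to the basis vector of `KP`
(with `K = ℚ`) indexed by its underlying composition (or to `0`), as a linear map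
from the coefficient field. -/
noncomputable def sgl : Option (List ℕ) → (ℚ →ₗ[ℚ] (Comp →₀ ℚ))
  | none => 0
  | some l =>
    Finsupp.lsingle ⟨l.filter (fun x => 0 < x), fun x hx => by
      simp only [List.mem_filter, decide_eq_true_eq] at hx
      exact hx.2⟩

/-- The linear endomorphism of `KP` given by the (pointwise finitely supported)
sum `Σ_{i ≥ 1} F i` of a family of operators on weak compositions. -/
noncomputable def sumOp (F : ℕ → Option (List ℕ) → Option (List ℕ)) :
    (Comp →₀ ℚ) →ₗ[ℚ] (Comp →₀ ℚ) :=
  Finsupp.lsum ℚ fun c => ∑ᶠ i ∈ Set.Ici (1 : ℕ), sgl (F i (some c.1))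

/-- The filtered down operator `D̃ = Σ_{∅ ≠ I ⊂ ℕ finite} 𝔡_I` as a linear
endomorphism of `KP`. -/
noncomputable def filteredD : (Comp →₀ ℚ) →ₗ[ℚ] (Comp →₀ ℚ) :=
  Finsupp.lsum ℚ fun c =>
    ∑ᶠ I ∈ {I : Finset ℕ | I.Nonempty ∧ ∀ j ∈ I, 0 < j}, sgl (dSet I (some c.1))

theorem removeAux_cons_of_some {i : ℕ} {xs ys : List ℕ} (h : removeAux i xs = some ys) (x : ℕ) :
    removeAux i (x :: xs) = some (x :: ys) := by
  simp only [removeAux, h]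

theorem removeAux_cons_of_none {i : ℕ} {xs : List ℕ} (h : removeAux i xs = none) (x : ℕ) :
    removeAux i (x :: xs) = if x = i then some ((i - 1) :: xs) else none := by
  simp only [removeAux, h]

theorem removeAux_eq_none_iff (i : ℕ) (l : List ℕ) : removeAux i l = none ↔ i ∉ l := by
  induction l with
  | nil => simp [removeAux]
  | cons x xs ih =>
    cases h : removeAux i xs with
    | none => simp [removeAux_cons_of_none h, ih.1 h, eq_comm]
    | some ys =>
      have : i ∈ xs := by
        by_contra hi
        simp [ih.2 hi] at h
      simp [removeAux_cons_of_some h, this]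

theorem addAux_eq_none_iff (j : ℕ) (l : List ℕ) : addAux j l = none ↔ j ∉ l := by
  induction l with
  | nil => simp [addAux]
  | cons x xs ih => by_cases h : x = j <;> simp [addAux, h, ih, Ne.symm]

theorem exists_removeAux {i : ℕ} {l : List ℕ} (h : i ∈ l) : ∃ m, removeAux i l = some m :=
  Option.ne_none_iff_exists'.1 fun hn => (removeAux_eq_none_iff i l).1 hn h

theorem exists_addAux {j : ℕ} {l : List ℕ} (h : j ∈ l) : ∃ m, addAux j l = some m :=
  Option.ne_none_iff_exists'.1 fun hn => (addAux_eq_none_iff j l).1 hn h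

theorem succ_mem_of_addAux {j : ℕ} {l m : List ℕ} (h : addAux j l = some m) : j + 1 ∈ m := by
  induction l generalizing m with
  | nil => simp [addAux] at h
  | cons x xs ih =>
    by_cases hx : x = j
    · simp only [addAux, hx, if_true, Option.some.injEq] at h
      simp [← h]
    · simp only [addAux, hx, if_false, Option.map_eq_some_iff] at h
      obtain ⟨ys, hys, rfl⟩ := h
      exact List.mem_cons_of_mem _ (ih hys)

theorem mem_iff_of_addAux {i j : ℕ} {l m : List ℕ} (h : addAux j l = some m) (hij : i ≠ j)
    (hij' : i ≠ j + 1) : i ∈ m ↔ i ∈ l := by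
  induction l generalizing m with
  | nil => simp [addAux] at h
  | cons x xs ih =>
    by_cases hx : x = j
    · simp only [addAux, hx, if_true, Option.some.injEq] at h
      simp [← h, hx, hij, hij']
    · simp only [addAux, hx, if_false, Option.map_eq_some_iff] at h
      obtain ⟨ys, hys, rfl⟩ := h
      simp [ih hys]

theorem removeAux_cons_of_ne {i x : ℕ} (h : x ≠ i) (xs : List ℕ) :
    removeAux i (x :: xs) = (removeAux i xs).map (x :: ·) := by
  cases h' : removeAux i xs with
  | none => simp [removeAux_cons_of_none h', h]
  | some ys => simp [removeAux_cons_of_some h']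

theorem addAux_cons_self (j : ℕ) (xs : List ℕ) : addAux j (j :: xs) = some ((j + 1) :: xs) := by
  simp [addAux]

theorem addAux_cons_of_ne {j x : ℕ} (h : x ≠ j) (xs : List ℕ) :
    addAux j (x :: xs) = (addAux j xs).map (x :: ·) := by
  simp [addAux, h]

/-- If neither operator touches a first part `x`, then `x` may be ignored. -/
theorem bind_map_cons {F G : List ℕ → Option (List ℕ)} {x : ℕ}
    (hG : ∀ xs, G (x :: xs) = (G xs).map (x :: ·)) (hF : ∀ xs, F (x :: xs) = (F xs).map (x :: ·))
    (xs : List ℕ) :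
    (F (x :: xs)).bind G = ((F xs).bind G).map (x :: ·) := by
  rw [hF]
  cases F xs <;> simp [hG]

/-- Removing a box from a part `i` commutes with adding a box to a part `j` if `i ≠ j + 1`. -/
theorem removeAux_addAux_comm {i j : ℕ} (hi : 0 < i) (hij : i ≠ j + 1) (l : List ℕ) :
    (addAux j l).bind (removeAux i) = (removeAux i l).bind (addAux j) := by
  induction l with
  | nil => simp [removeAux, addAux]
  | cons x xs ih =>
    by_cases hxj : x = j
    · subst hxj
      rw [addAux_cons_self, Option.bind_some, removeAux_cons_of_ne hij.symm]
      cases h : removeAux i xs with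
      | some ys => simp [removeAux_cons_of_some h, addAux_cons_self]
      | none =>
        by_cases hxi : x = i
        · subst hxi
          have : addAux x xs = none :=
            (addAux_eq_none_iff _ _).2 ((removeAux_eq_none_iff _ _).1 h)
          simp [removeAux_cons_of_none h, addAux_cons_of_ne (by omega : x - 1 ≠ x), this]
        · simp [removeAux_cons_of_none h, hxi]
    · by_cases hxi : x = i
      · subst hxi
        have hx := fun zs (h : addAux j xs = some zs) => mem_iff_of_addAux h hxj hij
        rw [addAux_cons_of_ne hxj]
        cases h : removeAux x xs with
        | some ys =>
          rw [h, Option.bind_some] at ih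
          rw [removeAux_cons_of_some h, Option.bind_some, addAux_cons_of_ne hxj, ← ih]
          cases h' : addAux j xs with
          | none => simp
          | some zs =>
            have hxs : x ∈ xs := by
              by_contra hn
              simp [(removeAux_eq_none_iff _ _).2 hn] at h
            obtain ⟨ws, hws⟩ := exists_removeAux ((hx zs h').2 hxs)
            simp [removeAux_cons_of_some hws, hws]
        | none =>
          rw [removeAux_cons_of_none h, if_pos rfl, Option.bind_some,
            addAux_cons_of_ne (by omega : x - 1 ≠ j)]
          cases h' : addAux j xs with
          | none => simp
          | some zs =>
            have hxs := (removeAux_eq_none_iff _ _).1 h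
            rw [← hx zs h', ← removeAux_eq_none_iff] at hxs
            simp [removeAux_cons_of_none hxs]
      · rw [bind_map_cons (removeAux_cons_of_ne hxi) (addAux_cons_of_ne hxj),
          bind_map_cons (addAux_cons_of_ne hxj) (removeAux_cons_of_ne hxi), ih]

theorem removeAux_addAux_of_notMem {k : ℕ} {l : List ℕ} (h : k ∈ l) (h' : k + 1 ∉ l) :
    (addAux k l).bind (removeAux (k + 1)) = some l := by
  induction l with
  | nil => simp at h
  | cons x xs ih =>
    simp only [List.mem_cons, not_or] at h h'
    by_cases hx : x = k
    · subst hx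
      simp [addAux_cons_self, removeAux_cons_of_none ((removeAux_eq_none_iff _ _).2 h'.2)]
    · rw [bind_map_cons (removeAux_cons_of_ne (Ne.symm h'.1)) (addAux_cons_of_ne hx),
        ih (h.resolve_left (Ne.symm hx)) h'.2, Option.map_some]

theorem addAux_removeAux_of_notMem {k : ℕ} {l : List ℕ} (h : k ∉ l) (h' : k + 1 ∈ l) :
    (removeAux (k + 1) l).bind (addAux k) = some l := by
  induction l with
  | nil => simp at h'
  | cons x xs ih =>
    simp only [List.mem_cons, not_or] at h h'
    by_cases hxs : k + 1 ∈ xs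
    · obtain ⟨ys, hys⟩ := exists_removeAux hxs
      have := ih h.2 hxs
      rw [hys, Option.bind_some] at this
      simp [removeAux_cons_of_some hys, addAux_cons_of_ne (Ne.symm h.1), this]
    · obtain rfl := h'.resolve_right hxs
      simp [removeAux_cons_of_none ((removeAux_eq_none_iff _ _).2 hxs), addAux_cons_self]

theorem removeAux_addAux_of_mem {k : ℕ} {l : List ℕ} (h : k ∈ l) (h' : k + 1 ∈ l) :
    (addAux k l).bind (removeAux (k + 1)) = (removeAux (k + 1) l).bind (addAux k) := by
  induction l with
  | nil => simp at h
  | cons x xs ih =>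
    simp only [List.mem_cons] at h h'
    by_cases hx : x = k
    · subst hx
      obtain ⟨ys, hys⟩ := exists_removeAux (h'.resolve_left (by omega))
      simp [addAux_cons_self, removeAux_cons_of_some hys]
    · have hk := h.resolve_left (Ne.symm hx)
      by_cases hxs : k + 1 ∈ xs
      · obtain ⟨ys, hys⟩ := exists_removeAux hxs
        obtain ⟨zs, hzs⟩ := exists_addAux hk
        obtain ⟨ws, hws⟩ := exists_removeAux (succ_mem_of_addAux hzs)
        have := ih hk hxs
        rw [hys, hzs, Option.bind_some, Option.bind_some, hws] at this
        simp [addAux_cons_of_ne hx, hzs, removeAux_cons_of_some hws, removeAux_cons_of_some hys,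
          ← this]
      · obtain rfl := h'.resolve_right hxs
        obtain ⟨zs, hzs⟩ := exists_addAux hk
        have := removeAux_addAux_of_notMem hk hxs
        rw [hzs, Option.bind_some] at this
        simp [addAux_cons_of_ne hx, hzs, removeAux_cons_of_some this,
          removeAux_cons_of_none ((removeAux_eq_none_iff _ _).2 hxs), addAux_cons_self]

theorem d_t_comm {i j : ℕ} (h : i ≠ j) (o : Option (List ℕ)) :
    d (i + 1) (t (j + 1) o) = t (j + 1) (d (i + 1) o) := by
  cases o with
  | none => cases j <;> rfl
  | some l =>
    cases j with
    | zero => exact removeAux_cons_of_ne (by omega) l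
    | succ j => exact removeAux_addAux_comm (by omega) (by omega) l

theorem d_eq_none {i : ℕ} {l : List ℕ} (h : i + 1 ∉ l) : d (i + 1) (some l) = none :=
  (removeAux_eq_none_iff _ _).2 h

theorem t_eq_none {j : ℕ} {l : List ℕ} (h : j + 1 ∉ l) : t (j + 2) (some l) = none :=
  (addAux_eq_none_iff _ _).2 h

theorem sgl_congr {l m : List ℕ} (h : l.filter (fun x => 0 < x) = m.filter (fun x => 0 < x)) :
    sgl (some l) = sgl (some m) := by
  simp only [sgl, h]

theorem sgl_eq_of_map_filter {o o' : Option (List ℕ)}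
    (h : o.map (List.filter (fun x => 0 < x)) = o'.map (List.filter (fun x => 0 < x))) :
    sgl o = sgl o' := by
  cases o <;> cases o' <;> simp at h
  · rfl
  · exact sgl_congr (by simpa using h)

theorem removeAux_filter (i : ℕ) (l : List ℕ) :
    (removeAux (i + 1) (l.filter (fun x => 0 < x))).map (List.filter (fun x => 0 < x)) =
      (removeAux (i + 1) l).map (List.filter (fun x => 0 < x)) := by
  induction l with
  | nil => rfl
  | cons x xs ih =>
    rcases Nat.eq_zero_or_pos x with rfl | hx
    · rw [removeAux_cons_of_ne (by omega), List.filter_cons_of_neg (by simp), ih, Option.map_map]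
      congr 1
    · rw [List.filter_cons_of_pos (by simpa)]
      cases h : removeAux (i + 1) xs with
      | none =>
        rw [h, Option.map_none, Option.map_eq_none_iff] at ih
        rw [removeAux_cons_of_none h, removeAux_cons_of_none ih]
        by_cases hxi : x = i + 1 <;> simp [hxi, List.filter_cons]
      | some ys =>
        rw [h, Option.map_some, Option.map_eq_some_iff] at ih
        obtain ⟨zs, hzs, hyz⟩ := ih
        simp [removeAux_cons_of_some h, removeAux_cons_of_some hzs, List.filter_cons, hyz]

theorem addAux_filter (j : ℕ) (l : List ℕ) :
    addAux (j + 1) (l.filter (fun x => 0 < x)) =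
      (addAux (j + 1) l).map (List.filter (fun x => 0 < x)) := by
  induction l with
  | nil => rfl
  | cons x xs ih =>
    rcases Nat.eq_zero_or_pos x with rfl | hx
    · rw [addAux_cons_of_ne (by omega), List.filter_cons_of_neg (by simp), ih, Option.map_map]
      congr 1
    · rw [List.filter_cons_of_pos (by simpa)]
      by_cases hxj : x = j + 1
      · simp [hxj, addAux_cons_self]
      · rw [addAux_cons_of_ne hxj, addAux_cons_of_ne hxj, ih, Option.map_map, Option.map_map]
        congr 1
        ext1 ys
        simp [hx]

theorem sgl_d_filter (i : ℕ) (l : List ℕ) :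
    sgl (d (i + 1) (some (l.filter (fun x => 0 < x)))) = sgl (d (i + 1) (some l)) :=
  sgl_eq_of_map_filter (removeAux_filter i l)

theorem sgl_t_filter (j : ℕ) (l : List ℕ) :
    sgl (t (j + 1) (some (l.filter (fun x => 0 < x)))) = sgl (t (j + 1) (some l)) := by
  apply sgl_eq_of_map_filter
  cases j with
  | zero => simp [t]
  | succ j => simp [t, addAux_filter, Option.map_map, Function.comp_def]

/-- On the image of `sgl`, the operator `sumOp F` is a finite sum. -/
theorem sumOp_sgl {F : ℕ → Option (List ℕ) → Option (List ℕ)}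
    (hF : ∀ i l, sgl (F (i + 1) (some (l.filter (fun x => 0 < x)))) = sgl (F (i + 1) (some l)))
    (hF₀ : ∀ i, F (i + 1) none = none) {N : ℕ} {o : Option (List ℕ)}
    (h : ∀ i, N ≤ i → F (i + 1) o = none) (r : ℚ) :
    sumOp F (sgl o r) = ∑ i ∈ Finset.range N, sgl (F (i + 1) o) r := by
  cases o with
  | none => simp [hF₀, sgl]
  | some l =>
    have key : ∑ᶠ i ∈ Set.Ici (1 : ℕ), sgl (F i (some (l.filter (fun x => 0 < x)))) =
        ∑ i ∈ Finset.range N, sgl (F (i + 1) (some l)) := by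
      rw [finsum_mem_eq_sum_of_inter_support_eq (t := Finset.Ico 1 (N + 1)),
        Finset.sum_Ico_eq_sum_range]
      · simp [hF, add_comm 1]
      · ext i
        cases i with
        | zero => simp
        | succ i =>
          simp only [Set.mem_inter_iff, Set.mem_Ici, Function.mem_support, Finset.coe_Ico,
            Set.mem_Ico, hF]
          refine and_congr_left fun hi => ?_
          have : i < N := by
            by_contra! hN
            exact hi (by rw [h i hN]; rfl)
          omega
    rw [← LinearMap.sum_apply, ← key]
    exact Finsupp.lsum_single ℚ _ _ _

/-- The commutator of `𝔡ⱼ` and `𝔱ⱼ` is multiplication by a difference of indicators. -/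
theorem sgl_d_t_sub (j : ℕ) (l : List ℕ) (r : ℚ) :
    sgl (d (j + 1) (t (j + 1) (some l))) r - sgl (t (j + 1) (d (j + 1) (some l))) r =
      (if j = 0 ∨ j ∈ l then sgl (some l) r else 0) -
        (if j + 1 = 0 ∨ j + 1 ∈ l then sgl (some l) r else 0) := by
  cases j with
  | zero =>
    by_cases h : 1 ∈ l
    · obtain ⟨m, hm⟩ := exists_removeAux h
      simp [d, t, removeAux, hm, h]
    · have hm := (removeAux_eq_none_iff 1 l).2 h
      simp [d, t, removeAux, hm, h, sgl]
  | succ k =>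
    have e1 : d (k + 2) (t (k + 2) (some l)) =
      (addAux (k + 1) l).bind (removeAux (k + 2)) := rfl
    have e2 : t (k + 2) (d (k + 2) (some l)) =
      (removeAux (k + 2) l).bind (addAux (k + 1)) := rfl
    rw [e1, e2]
    by_cases h : k + 1 ∈ l <;> by_cases h' : k + 2 ∈ l
    · simp [removeAux_addAux_of_mem h h', h, h']
    · simp [removeAux_addAux_of_notMem h h', h, h', (removeAux_eq_none_iff _ _).2 h', sgl]
    · simp [addAux_removeAux_of_notMem h h', h, h', (addAux_eq_none_iff _ _).2 h, sgl]
    · simp [h, h', (addAux_eq_none_iff _ _).2 h, (removeAux_eq_none_iff _ _).2 h', sgl]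

/-- Theorem 3.9: the left composition poset `L_c` and the quasisymmetric
composition poset `Q_c` are dual graded graphs: with `Ũ = Σ_{i≥1} 𝔱ᵢ` and
`D = Σ_{i≥1} 𝔡ᵢ` acting on the free vector space on compositions, `DŨ - ŨD = Id`. -/
theorem LcQc_dual_graded :
    (sumOp d).comp (sumOp t) - (sumOp t).comp (sumOp d) = LinearMap.id := by
  refine Finsupp.lhom_ext fun c r => ?_
  obtain ⟨l, hl⟩ := c
  have hs : Finsupp.single (⟨l, hl⟩ : Comp) r = sgl (some l) r := by
    have : l.filter (fun x => 0 < x) = l := List.filter_eq_self.2 (by simpa using hl)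
    simp [sgl, this]
  obtain ⟨N, hN, hlN⟩ : ∃ N, 0 < N ∧ ∀ i, N ≤ i → i ∉ l :=
    ⟨l.sum + 1, by omega, fun i hi hil => by have := List.le_sum_of_mem hil; omega⟩
  have hd : ∀ i, N ≤ i → d (i + 1) (some l) = none := fun i hi => d_eq_none (hlN _ (by omega))
  have ht : ∀ i, N ≤ i → t (i + 1) (some l) = none := by
    intro i hi
    obtain ⟨k, rfl⟩ := Nat.exists_eq_succ_of_ne_zero (by omega : i ≠ 0)
    exact t_eq_none (hlN _ hi)
  have hd₀ : ∀ i, d (i + 1) none = none := fun _ => rfl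
  have ht₀ : ∀ i, t (i + 1) none = none := fun i => by cases i <;> rfl
  have hdt : sumOp d (sumOp t (sgl (some l) r)) = ∑ j ∈ Finset.range N, ∑ i ∈ Finset.range N,
      sgl (d (i + 1) (t (j + 1) (some l))) r := by
    rw [sumOp_sgl sgl_t_filter ht₀ ht, map_sum]
    refine Finset.sum_congr rfl fun j hj => sumOp_sgl sgl_d_filter hd₀ (fun i hi => ?_) r
    rw [d_t_comm (by grind), hd i hi, ht₀]
  have htd : sumOp t (sumOp d (sgl (some l) r)) = ∑ j ∈ Finset.range N, ∑ i ∈ Finset.range N,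
      sgl (t (j + 1) (d (i + 1) (some l))) r := by
    rw [sumOp_sgl sgl_d_filter hd₀ hd, map_sum, Finset.sum_comm]
    refine Finset.sum_congr rfl fun i hi => sumOp_sgl sgl_t_filter ht₀ (fun j hj => ?_) r
    rw [← d_t_comm (by grind), ht j hj, hd₀]
  rw [hs, LinearMap.sub_apply, LinearMap.comp_apply, LinearMap.comp_apply, hdt, htd,
    LinearMap.id_apply, ← Finset.sum_sub_distrib]
  calc _ = ∑ j ∈ Finset.range N, ((if j = 0 ∨ j ∈ l then sgl (some l) r else 0) -
        (if j + 1 = 0 ∨ j + 1 ∈ l then sgl (some l) r else 0)) := by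
        refine Finset.sum_congr rfl fun j hj => ?_
        rw [← Finset.sum_sub_distrib, Finset.sum_eq_single_of_mem j hj fun i _ hij => by
          rw [d_t_comm hij, sub_self], sgl_d_t_sub]
    _ = sgl (some l) r := by
        rw [Finset.sum_range_sub' fun j => if j = 0 ∨ j ∈ l then sgl (some l) r else 0]
        simp [hlN N le_rfl, hN.ne']

end CompOps
end

section
/- Let α be a composition with largest part m, let I be a finite set of positive integers and i ∈ I with i > m such that 𝔡_I 𝔱_i(α) ≠ 0. Then i = m + 1, every element of I \ {m + 1} is at most m, and 𝔡_I 𝔱_{m+1}(α) = 𝔡_{I \ {m+1}}(α); in particular 𝔡_{m+1} 𝔱_{m+1}(α) = α. -/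
namespace CompOps

theorem removeAux_of_notMem {i : ℕ} {l : List ℕ} (h : i ∉ l) : removeAux i l = none := by
  induction l with
  | nil => rfl
  | cons x xs ih =>
    rw [List.mem_cons, not_or] at h
    simp [removeAux, ih h.2, Ne.symm h.1]

theorem mem_of_addAux_eq_some {j : ℕ} {l l' : List ℕ} (h : addAux j l = some l') : j ∈ l := by
  induction l generalizing l' with
  | nil => simp [addAux] at h
  | cons x xs ih =>
    by_cases hx : x = j
    · simp [hx]
    · simp only [addAux, hx, if_false, Option.map_eq_some_iff] at h
      obtain ⟨ys, hys, -⟩ := h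
      exact List.mem_cons_of_mem _ (ih hys)

theorem le_of_addAux_eq_some {j : ℕ} {l l' : List ℕ} (hl : ∀ x ∈ l, x ≤ j)
    (h : addAux j l = some l') : ∀ x ∈ l', x ≤ j + 1 := by
  induction l generalizing l' with
  | nil => simp [addAux] at h
  | cons x xs ih =>
    rw [List.forall_mem_cons] at hl
    by_cases hx : x = j
    · simp only [addAux, hx, if_true, Option.some.injEq] at h
      subst h
      exact List.forall_mem_cons.2 ⟨le_rfl, fun y hy => (hl.2 y hy).trans j.le_succ⟩
    · simp only [addAux, hx, if_false, Option.map_eq_some_iff] at h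
      obtain ⟨ys, hys, rfl⟩ := h
      exact List.forall_mem_cons.2 ⟨hl.1.trans j.le_succ, ih hl.2 hys⟩

theorem removeAux_addAux {j : ℕ} {l l' : List ℕ} (hl : ∀ x ∈ l, x ≤ j)
    (h : addAux j l = some l') : removeAux (j + 1) l' = some l := by
  induction l generalizing l' with
  | nil => simp [addAux] at h
  | cons x xs ih =>
    rw [List.forall_mem_cons] at hl
    by_cases hx : x = j
    · simp only [addAux, hx, if_true, Option.some.injEq] at h
      subst h
      have hxs : j + 1 ∉ xs := fun hm => absurd (hl.2 _ hm) (by omega)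
      simp [removeAux, removeAux_of_notMem hxs, hx]
    · simp only [addAux, hx, if_false, Option.map_eq_some_iff] at h
      obtain ⟨ys, hys, rfl⟩ := h
      simp [removeAux, ih hl.2 hys]

theorem d_none (i : ℕ) : d i none = none := by
  cases i <;> rfl

theorem d_some_of_notMem {i : ℕ} {l : List ℕ} (hi : 0 < i) (h : i ∉ l) :
    d i (some l) = none := by
  obtain ⟨k, rfl⟩ := Nat.exists_eq_succ_of_ne_zero hi.ne'
  exact removeAux_of_notMem h

theorem foldr_d_comp_apply (L : List ℕ) (f : Option (List ℕ) → Option (List ℕ))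
    (o : Option (List ℕ)) :
    L.foldr (fun i f => d i ∘ f) f o = L.foldr (fun i f => d i ∘ f) id (f o) := by
  induction L with
  | nil => rfl
  | cons x xs ih => simp [ih]

theorem dSet_none (I : Finset ℕ) : dSet I none = none := by
  unfold dSet
  induction I.sort (· ≤ ·) with
  | nil => rfl
  | cons x xs ih => simp [ih, d_none]

theorem sort_eq_sort_erase_append {I : Finset ℕ} {M : ℕ} (hM : M ∈ I) (h : ∀ j ∈ I, j ≤ M) :
    I.sort (· ≤ ·) = (I.erase M).sort (· ≤ ·) ++ [M] := by
  refine List.Perm.eq_of_pairwise' (r := (· ≤ ·)) (Finset.pairwise_sort _ _) ?_ ?_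
  · refine List.pairwise_append.2 ⟨Finset.pairwise_sort _ _, List.pairwise_singleton _ _, ?_⟩
    intro x hx y hy
    rw [Finset.mem_sort] at hx
    rw [List.mem_singleton.1 hy]
    exact h x (Finset.mem_of_mem_erase hx)
  · refine (List.perm_ext_iff_of_nodup (Finset.sort_nodup _ _) ?_).2 fun x => ?_
    · simp +contextual [List.nodup_append, Finset.sort_nodup]
    · by_cases hx : x = M <;> simp [hx, hM]

/-- The largest index of `I` acts first in `𝔡_I`. -/
theorem dSet_eq_dSet_erase {I : Finset ℕ} {M : ℕ} (hM : M ∈ I) (h : ∀ j ∈ I, j ≤ M)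
    (o : Option (List ℕ)) : dSet I o = dSet (I.erase M) (d M o) := by
  unfold dSet
  rw [sort_eq_sort_erase_append hM h, List.foldr_append, foldr_d_comp_apply]
  rfl

theorem le_of_dSet_ne_none {I : Finset ℕ} {l : List ℕ} {b : ℕ} (hl : ∀ x ∈ l, x ≤ b)
    (h : dSet I (some l) ≠ none) : ∀ j ∈ I, j ≤ b := by
  intro j hj
  by_contra! hlt
  have hne : I.Nonempty := ⟨j, hj⟩
  have hb : b < I.max' hne := hlt.trans_le (I.le_max' j hj)
  refine h ?_
  rw [dSet_eq_dSet_erase (I.max'_mem hne) fun k hk => I.le_max' k hk,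
    d_some_of_notMem (by omega) fun hm => absurd (hl _ hm) (by omega), dSet_none]

theorem le_foldr_max {l : List ℕ} {x : ℕ} (hx : x ∈ l) : x ≤ l.foldr max 0 := by
  induction l with
  | nil => simp at hx
  | cons y ys ih =>
    rcases List.mem_cons.1 hx with rfl | hx
    · exact le_max_left _ _
    · exact (ih hx).trans (le_max_right _ _)

/-- Let `α` be a composition with largest part `m`, `I` a finite set of positive
integers and `i ∈ I` with `i > m` such that `𝔡_I 𝔱ᵢ(α) ≠ 0`. Then `i = m + 1`, every
element of `I \ {m + 1}` is at most `m`, and `𝔡_I 𝔱_{m+1}(α) = 𝔡_{I \ {m+1}}(α)`; in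
particular `𝔡_{m+1} 𝔱_{m+1}(α) = α`. -/
theorem top_box (α : List ℕ) (hα : ∀ x ∈ α, 0 < x) (hne : α ≠ [])
    (I : Finset ℕ) (hI : ∀ j ∈ I, 0 < j) (i : ℕ) (hi : i ∈ I)
    (him : α.foldr max 0 < i) (h : dSet I (t i (some α)) ≠ none) :
    i = α.foldr max 0 + 1 ∧
    (∀ j ∈ I, j ≠ α.foldr max 0 + 1 → j ≤ α.foldr max 0) ∧
    dSet I (t (α.foldr max 0 + 1) (some α)) =
      dSet (I.erase (α.foldr max 0 + 1)) (some α) ∧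
    d (α.foldr max 0 + 1) (t (α.foldr max 0 + 1) (some α)) = some α := by
  have hle : ∀ x ∈ α, x ≤ α.foldr max 0 := fun x hx => le_foldr_max hx
  generalize α.foldr max 0 = m at him hle ⊢
  obtain ⟨x, hx⟩ := List.exists_mem_of_ne_nil α hne
  have hm : 0 < m := (hα x hx).trans_le (hle x hx)
  obtain ⟨k, rfl⟩ : ∃ k, i = k + 2 := ⟨i - 2, by omega⟩
  change dSet I (addAux (k + 1) α) ≠ none at h
  cases hβ : addAux (k + 1) α with
  | none => exact absurd (by rw [hβ, dSet_none]) h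
  | some β =>
    obtain rfl : m = k + 1 := by
      have := hle _ (mem_of_addAux_eq_some hβ)
      omega
    rw [hβ] at h
    have hI_le := le_of_dSet_ne_none (le_of_addAux_eq_some hle hβ) h
    have ht : t (k + 1 + 1) (some α) = some β := hβ
    have hd : d (k + 1 + 1) (some β) = some α := removeAux_addAux hle hβ
    refine ⟨rfl, fun j hj hne => ?_, ?_, ?_⟩
    · have := hI_le j hj
      omega
    · rw [ht, dSet_eq_dSet_erase hi hI_le, hd]
    · rw [ht, hd]

end CompOps
end
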